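/- arXiv:2603.03759 — 5 statements merged into one kernel-verified Lean document; each statement's English description precedes it below -/
import Mathlib

section
/- For all Q, Q' : S × A → ℝ, ‖T Q − T Q'‖_∞ ≤ γ·‖Q − Q'‖_∞; that is, the Bellman optimality operator is a γ-contraction in the sup norm. -/
/-- The Bellman optimality operator:
`(T Q)(s,a) = r(s,a) + γ · Σ_{s'} P(s,a)(s') · max_{a'} Q(s',a')`. -/
noncomputable def bellman {S A : Type*} [Fintype S] [Fintype A] [Nonempty A]
    (r : S → A → ℝ) (P : S → A → S → ℝ) (γ : ℝ) (Q : S → A → ℝ) : S → A → ℝ :=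
  fun s a => r s a + γ * ∑ s' : S, P s a s' *
    Finset.univ.sup' Finset.univ_nonempty (fun a' => Q s' a')

/-- The sup norm `‖Q‖_∞ = max_{(s,a)} |Q(s,a)|`. -/
noncomputable def supNorm {S A : Type*} [Fintype S] [Fintype A] [Nonempty S] [Nonempty A]
    (Q : S → A → ℝ) : ℝ :=
  Finset.univ.sup' Finset.univ_nonempty (fun p : S × A => |Q p.1 p.2|)

/-- The Bellman optimality operator is a `γ`-contraction in the sup norm. -/
theorem bellman_contraction {S A : Type*}
    [Fintype S] [Fintype A] [Nonempty S] [Nonempty A]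
    (r : S → A → ℝ) (P : S → A → S → ℝ) (γ : ℝ)
    (hγ0 : 0 < γ) (hγ1 : γ < 1)
    (hP0 : ∀ s a s', 0 ≤ P s a s')
    (hP1 : ∀ s a, ∑ s' : S, P s a s' = 1)
    (Q Q' : S → A → ℝ) :
    supNorm (fun s a => bellman r P γ Q s a - bellman r P γ Q' s a) ≤
      γ * supNorm (fun s a => Q s a - Q' s a) := by
  have key : ∀ (U V : S → A → ℝ) (M : ℝ), (∀ s a, U s a - V s a ≤ M) → ∀ s a,
      bellman r P γ U s a - bellman r P γ V s a ≤ γ * M := by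
    intro U V M h s a
    have h1 : ∀ s', Finset.univ.sup' Finset.univ_nonempty (fun a' => U s' a') ≤
        Finset.univ.sup' Finset.univ_nonempty (fun a' => V s' a') + M := by
      intro s'
      refine Finset.sup'_le _ _ fun a' _ => ?_
      have h2 := Finset.le_sup' (fun a' => V s' a') (Finset.mem_univ a')
      have h3 := h s' a'
      linarith
    have h4 : ∑ s' : S, P s a s' * Finset.univ.sup' Finset.univ_nonempty (fun a' => U s' a') ≤
        ∑ s' : S, P s a s' *
          (Finset.univ.sup' Finset.univ_nonempty (fun a' => V s' a') + M) :=
      Finset.sum_le_sum fun s' _ => mul_le_mul_of_nonneg_left (h1 s') (hP0 s a s')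
    simp only [mul_add, Finset.sum_add_distrib] at h4
    rw [← Finset.sum_mul, hP1, one_mul] at h4
    have h5 := mul_le_mul_of_nonneg_left h4 hγ0.le
    unfold bellman
    linarith
  have hb : ∀ s a, |Q s a - Q' s a| ≤ supNorm (fun s a => Q s a - Q' s a) := fun s a =>
    Finset.le_sup' (fun p : S × A => |Q p.1 p.2 - Q' p.1 p.2|) (Finset.mem_univ (s, a))
  refine Finset.sup'_le _ _ fun p _ => ?_
  rw [abs_sub_le_iff]
  exact ⟨key Q Q' _ (fun s a => (abs_sub_le_iff.1 (hb s a)).1) _ _,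
    key Q' Q _ (fun s a => (abs_sub_le_iff.1 (hb s a)).2) _ _⟩
end

section
/- Let r̃ > 0 and suppose Q : S × A → ℝ satisfies ‖Q‖_∞ ≤ r̃/(1−γ). Then for every η > 0, the probability under p of the event {ω ∈ Ω : ‖T̂_ω Q − T Q‖_∞ ≥ γ·η} is at most 2·|S|·|A|·exp(−m·(1−γ)²·η²/(2·r̃²)); that is, the sup-norm deviation of the m-sample empirical Bellman operator from the exact Bellman operator at the fixed function Q obeys a Hoeffding-plus-union-bound tail simultaneously over all state-action pairs. -/
/-- The empirical Bellman operator determined by the sample draw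
`ω : S × A × Fin m → S`:
`(T̂_ω Q)(s,a) = r(s,a) + (γ/m) · Σ_{j} max_{a'} Q(ω(s,a,j), a')`. -/
noncomputable def empBellman {S A : Type*} [Fintype A] [Nonempty A]
    (m : ℕ) (ω : S × A × Fin m → S)
    (r : S → A → ℝ) (γ : ℝ) (Q : S → A → ℝ) : S → A → ℝ :=
  fun s a => r s a + (γ / (m : ℝ)) * ∑ j : Fin m,
    Finset.univ.sup' Finset.univ_nonempty (fun a' => Q (ω (s, a, j)) a')

/-- The probability mass function on sample draws:
`p(ω) = Π_{(s,a,j)} P(s,a)(ω(s,a,j))`. -/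
noncomputable def samplePmf {S A : Type*} [Fintype S] [Fintype A]
    (m : ℕ) (P : S → A → S → ℝ) (ω : S × A × Fin m → S) : ℝ :=
  ∏ q : S × A × Fin m, P q.1 q.2.1 (ω q)

open MeasureTheory ProbabilityTheory in
lemma hoeff_aux {S : Type*} [Fintype S] (p : S → ℝ) (hp0 : ∀ s, 0 ≤ p s)
    (hp1 : ∑ s, p s = 1) (V : S → ℝ) (B : ℝ) (hV : ∀ s, |V s| ≤ B) (t : ℝ) :
    ∑ x, p x * Real.exp (t * (V x - ∑ y, p y * V y)) ≤ Real.exp (B ^ 2 * t ^ 2 / 2) := by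
  letI : MeasurableSpace S := ⊤
  let μ : Measure S := ∑ s, ENNReal.ofReal (p s) • Measure.dirac s
  have hint : ∀ f : S → ℝ, ∫ x, f x ∂μ = ∑ x, p x * f x := by
    intro f
    rw [integral_finsetSum_measure]
    · refine Finset.sum_congr rfl fun s _ => ?_
      rw [integral_smul_measure, integral_dirac, ENNReal.toReal_ofReal (hp0 s), smul_eq_mul]
    · intro s _
      exact (integrable_dirac (by simp)).smul_measure ENNReal.ofReal_ne_top
  haveI : IsProbabilityMeasure μ := by
    constructor
    simp only [μ, Measure.coe_finset_sum, Finset.sum_apply, Measure.smul_apply, measure_univ,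
      smul_eq_mul, mul_one]
    rw [← ENNReal.ofReal_sum_of_nonneg (fun s _ => hp0 s), hp1, ENNReal.ofReal_one]
  have h := hasSubgaussianMGF_of_mem_Icc (μ := μ) (X := V) (a := -B) (b := B)
    (measurable_from_top.aemeasurable) (Filter.Eventually.of_forall fun s => abs_le.mp (hV s))
  have h2 := h.mgf_le t
  simp only [mgf, hint] at h2
  refine h2.trans (le_of_eq ?_)
  congr 1
  have : ((‖B - -B‖₊ / 2) ^ 2 : NNReal) = (B ^ 2 : ℝ) := by
    push_cast
    rw [Real.norm_eq_abs, div_pow, sq_abs]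
    ring
  rw [this]

open Classical in
lemma prod_aux {S A : Type*} [Fintype S] [Fintype A] (m : ℕ) (s : S) (a : A) (f : Fin m → ℝ) :
    ∏ q : S × A × Fin m, (if q.1 = s ∧ q.2.1 = a then f q.2.2 else 1) = ∏ j, f j := by
  rw [Fintype.prod_prod_type, Finset.prod_eq_single s, Fintype.prod_prod_type,
    Finset.prod_eq_single a]
  · simp
  · intro b _ hb
    simp [hb]
  · simp
  · intro b _ hb
    simp [hb]
  · simp

open Classical in
lemma tail_aux {S A : Type*} [Fintype S] [Fintype A] (P : S → A → S → ℝ)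
    (hP0 : ∀ s a s', 0 ≤ P s a s') (hP1 : ∀ s a, ∑ s' : S, P s a s' = 1)
    (m : ℕ) (V : S → ℝ) (B : ℝ) (hB : 0 < B) (hV : ∀ s, |V s| ≤ B) (η : ℝ) (hη : 0 < η)
    (s : S) (a : A) :
    (∑ ω : S × A × Fin m → S,
      if m * η ≤ ∑ j, (V (ω (s, a, j)) - ∑ y, P s a y * V y) then samplePmf m P ω else 0) ≤
      Real.exp (-(m * η ^ 2 / (2 * B ^ 2))) := by
  have hp : ∀ ω, 0 ≤ samplePmf m P ω := fun ω => Finset.prod_nonneg fun q _ => hP0 _ _ _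
  set c := ∑ y, P s a y * V y with hc
  set t := η / B ^ 2 with ht
  have ht0 : 0 < t := by positivity
  let g : S × A × Fin m → S → ℝ := fun q x =>
    if q.1 = s ∧ q.2.1 = a then Real.exp (t * (V x - c)) else 1
  have hg : ∀ ω : S × A × Fin m → S,
      Real.exp (t * ∑ j, (V (ω (s, a, j)) - c)) = ∏ q, g q (ω q) := by
    intro ω
    rw [Finset.mul_sum, Real.exp_sum, ← prod_aux m s a]
    refine Finset.prod_congr rfl ?_
    rintro ⟨s', a', j⟩ _
    simp only [g]
    split_ifs with h
    · obtain ⟨rfl, rfl⟩ := h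
      rfl
    · rfl
  have hM : ∑ ω : S × A × Fin m → S, samplePmf m P ω * ∏ q, g q (ω q)
      ≤ Real.exp (B ^ 2 * t ^ 2 / 2) ^ m := by
    simp only [samplePmf, ← Finset.prod_mul_distrib]
    rw [← Fintype.prod_sum (fun q x => P q.1 q.2.1 x * g q x)]
    have : ∀ q : S × A × Fin m, ∑ x, P q.1 q.2.1 x * g q x =
        if q.1 = s ∧ q.2.1 = a then ∑ x, P s a x * Real.exp (t * (V x - c)) else 1 := by
      rintro ⟨s', a', j⟩
      simp only [g]
      split_ifs with h
      · obtain ⟨rfl, rfl⟩ := h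
        rfl
      · simp [hP1]
    rw [Finset.prod_congr rfl (fun q _ => this q),
      prod_aux m s a (fun _ => ∑ x, P s a x * Real.exp (t * (V x - c)))]
    rw [Finset.prod_const, Finset.card_univ, Fintype.card_fin]
    exact pow_le_pow_left₀
      (Finset.sum_nonneg fun x _ => mul_nonneg (hP0 _ _ _) (Real.exp_pos _).le)
      (hoeff_aux (P s a) (hP0 s a) (hP1 s a) V B hV t) m
  calc _ ≤ ∑ ω : S × A × Fin m → S,
        Real.exp (-(t * (m * η))) * (samplePmf m P ω * ∏ q, g q (ω q)) := by
        refine Finset.sum_le_sum fun ω _ => ?_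
        rw [← hg]
        split_ifs with h
        · have : 1 ≤ Real.exp (-(t * (m * η))) * Real.exp (t * ∑ j, (V (ω (s, a, j)) - c)) := by
            rw [← Real.exp_add]
            apply Real.one_le_exp
            have := mul_le_mul_of_nonneg_left h ht0.le
            linarith
          calc samplePmf m P ω = samplePmf m P ω * 1 := (mul_one _).symm
            _ ≤ _ := mul_le_mul_of_nonneg_left this (hp ω)
            _ = _ := by ring
        · exact mul_nonneg (Real.exp_pos _).le (mul_nonneg (hp ω) (Real.exp_pos _).le)
    _ ≤ Real.exp (-(t * (m * η))) * Real.exp (B ^ 2 * t ^ 2 / 2) ^ m := by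
        rw [← Finset.mul_sum]
        exact mul_le_mul_of_nonneg_left hM (Real.exp_pos _).le
    _ = _ := by
        rw [← Real.exp_nat_mul, ← Real.exp_add, ht]
        congr 1
        field_simp
        ring

open Classical in
/-- Hoeffding-plus-union-bound tail for the sup-norm deviation of the
`m`-sample empirical Bellman operator from the exact Bellman operator at a
fixed function `Q` with `‖Q‖_∞ ≤ r̃/(1−γ)`. -/
theorem empBellman_deviation_tail {S A : Type*}
    [Fintype S] [Fintype A] [Nonempty S] [Nonempty A]
    (r : S → A → ℝ) (P : S → A → S → ℝ) (γ : ℝ)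
    (hγ0 : 0 < γ) (hγ1 : γ < 1)
    (hP0 : ∀ s a s', 0 ≤ P s a s')
    (hP1 : ∀ s a, ∑ s' : S, P s a s' = 1)
    (m : ℕ) (hm : 1 ≤ m)
    (rtil : ℝ) (hrtil : 0 < rtil)
    (Q : S → A → ℝ) (hQ : supNorm Q ≤ rtil / (1 - γ))
    (η : ℝ) (hη : 0 < η) :
    (∑ ω : S × A × Fin m → S,
        if γ * η ≤ supNorm (fun s a => empBellman m ω r γ Q s a - bellman r P γ Q s a)
        then samplePmf m P ω else 0) ≤
      2 * (Fintype.card S : ℝ) * (Fintype.card A : ℝ) *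
        Real.exp (-((m : ℝ) * (1 - γ) ^ 2 * η ^ 2) / (2 * rtil ^ 2)) := by
  have h1γ : 0 < 1 - γ := by linarith
  have hm0 : (0 : ℝ) < m := by exact_mod_cast hm
  set B := rtil / (1 - γ) with hBdef
  have hB : 0 < B := by positivity
  let V : S → ℝ := fun x => Finset.univ.sup' Finset.univ_nonempty (fun a' => Q x a')
  have hQb : ∀ s a, |Q s a| ≤ B := fun s a =>
    (Finset.le_sup' (fun p : S × A => |Q p.1 p.2|) (Finset.mem_univ (s, a))).trans hQ
  have hV : ∀ x, |V x| ≤ B := by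
    intro x
    obtain ⟨a, _, ha⟩ := Finset.exists_mem_eq_sup' (Finset.univ_nonempty (α := A))
      (fun a' => Q x a')
    simp only [V]
    rw [ha]
    exact hQb x a
  have hp : ∀ ω, 0 ≤ samplePmf m P ω := fun ω => Finset.prod_nonneg fun q _ => hP0 _ _ _
  have hV' : ∀ x, |(-V) x| ≤ B := fun x => by simpa using hV x
  let F : (S → ℝ) → S × A → (S × A × Fin m → S) → ℝ := fun W k ω =>
    if m * η ≤ ∑ j, (W (ω (k.1, k.2, j)) - ∑ y, P k.1 k.2 y * W y) then samplePmf m P ω else 0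
  have hF0 : ∀ W k ω, 0 ≤ F W k ω := by
    intro W k ω
    simp only [F]
    split_ifs
    · exact hp ω
    · exact le_rfl
  have key : ∀ ω : S × A × Fin m → S,
      (if γ * η ≤ supNorm (fun s a => empBellman m ω r γ Q s a - bellman r P γ Q s a)
        then samplePmf m P ω else 0) ≤ ∑ k : S × A, (F V k ω + F (-V) k ω) := by
    intro ω
    split_ifs with h
    · obtain ⟨k, _, hk⟩ := Finset.exists_mem_eq_sup' (Finset.univ_nonempty (α := S × A))
        (fun p : S × A => |empBellman m ω r γ Q p.1 p.2 - bellman r P γ Q p.1 p.2|)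
      have h' : γ * η ≤ |empBellman m ω r γ Q k.1 k.2 - bellman r P γ Q k.1 k.2| := by
        rw [← hk]
        exact h
      have e : empBellman m ω r γ Q k.1 k.2 - bellman r P γ Q k.1 k.2 =
          γ / m * ∑ j, (V (ω (k.1, k.2, j)) - ∑ y, P k.1 k.2 y * V y) := by
        simp only [empBellman, bellman, V, Finset.sum_sub_distrib, Finset.sum_const,
          Finset.card_univ, Fintype.card_fin, nsmul_eq_mul]
        field_simp
        ring
      rw [e, abs_mul, abs_of_pos (div_pos hγ0 hm0)] at h'
      have h2 : m * η ≤ |∑ j, (V (ω (k.1, k.2, j)) - ∑ y, P k.1 k.2 y * V y)| := by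
        have h3 := mul_le_mul_of_nonneg_left h' (div_pos hm0 hγ0).le
        have e1 : (m : ℝ) / γ * (γ * η) = m * η := by field_simp
        rw [e1, ← mul_assoc] at h3
        have e2 : (m : ℝ) / γ * (γ / m) = 1 := by field_simp
        rwa [e2, one_mul] at h3
      refine le_trans ?_ (Finset.single_le_sum
        (f := fun k => F V k ω + F (-V) k ω)
        (fun k _ => add_nonneg (hF0 _ _ _) (hF0 _ _ _)) (Finset.mem_univ k))
      rcases le_abs.mp h2 with h3 | h3
      · have : F V k ω = samplePmf m P ω := if_pos h3
        have := hF0 (-V) k ω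
        linarith
      · have : F (-V) k ω = samplePmf m P ω := by
          apply if_pos
          refine h3.trans (le_of_eq ?_)
          rw [← Finset.sum_neg_distrib]
          refine Finset.sum_congr rfl fun j _ => ?_
          simp only [Pi.neg_apply, mul_neg, Finset.sum_neg_distrib]
          ring
        have := hF0 V k ω
        linarith
    · exact Finset.sum_nonneg fun k _ => add_nonneg (hF0 _ _ _) (hF0 _ _ _)
  refine (Finset.sum_le_sum fun ω _ => key ω).trans ?_
  rw [Finset.sum_comm]
  calc _ ≤ ∑ k : S × A, (2 * Real.exp (-(m * η ^ 2 / (2 * B ^ 2)))) := by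
        refine Finset.sum_le_sum fun k _ => ?_
        rw [Finset.sum_add_distrib]
        have h1 := tail_aux P hP0 hP1 m V B hB hV η hη k.1 k.2
        have h2 := tail_aux P hP0 hP1 m (-V) B hB hV' η hη k.1 k.2
        simp only [F]
        linarith
    _ = _ := by
        rw [Finset.sum_const, Finset.card_univ, Fintype.card_prod, nsmul_eq_mul]
        have : -(m * η ^ 2 / (2 * B ^ 2)) =
            -((m : ℝ) * (1 - γ) ^ 2 * η ^ 2) / (2 * rtil ^ 2) := by
          rw [hBdef]
          field_simp
        rw [this]
        push_cast
        ring
end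

section
/- Suppose |r(s,a)| ≤ r̃ for all (s,a) ∈ S × A, with r̃ > 0, and let Q* : S × A → ℝ satisfy T Q* = Q*. Let N = |S|·|A| and let ρ ∈ (0,1). Then the probability under p of the event {ω ∈ Ω : every Q̂ : S × A → ℝ with T̂_ω Q̂ = Q̂ satisfies ‖Q̂ − Q*‖_∞ ≤ (γ·r̃/(1−γ)²)·√(2·ln(2N/ρ)/m)} is at least 1 − ρ; that is, with probability at least 1 − ρ over the m i.i.d. next-state samples drawn per state-action pair, the fixed point of the empirical Bellman operator deviates from the exact fixed point by at most (γ r̃/(1−γ)²)·√(2 ln(2N/ρ)/m) in sup norm. -/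
theorem aux_sup_sub {A : Type*} [Fintype A] [Nonempty A] (f g : A → ℝ) (M : ℝ)
    (h : ∀ a, |f a - g a| ≤ M) :
    |Finset.univ.sup' Finset.univ_nonempty f - Finset.univ.sup' Finset.univ_nonempty g| ≤ M := by
  rw [abs_le]
  constructor
  · have : Finset.univ.sup' Finset.univ_nonempty g ≤
        Finset.univ.sup' Finset.univ_nonempty f + M := by
      apply Finset.sup'_le
      intro a _
      have h1 := Finset.le_sup' f (Finset.mem_univ a)
      have h2 := (abs_le.1 (h a)).1
      linarith
    linarith
  · have : Finset.univ.sup' Finset.univ_nonempty f ≤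
        Finset.univ.sup' Finset.univ_nonempty g + M := by
      apply Finset.sup'_le
      intro a _
      have h1 := Finset.le_sup' g (Finset.mem_univ a)
      have h2 := (abs_le.1 (h a)).2
      linarith
    linarith

theorem aux_sup_abs {A : Type*} [Fintype A] [Nonempty A] (f : A → ℝ) (M : ℝ)
    (h : ∀ a, |f a| ≤ M) : |Finset.univ.sup' Finset.univ_nonempty f| ≤ M := by
  have := aux_sup_sub f (fun _ => 0) M (by simpa using h)
  simpa using this

theorem aux_le_supNorm {S A : Type*} [Fintype S] [Fintype A] [Nonempty S] [Nonempty A]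
    (Q : S → A → ℝ) (s : S) (a : A) : |Q s a| ≤ supNorm Q :=
  Finset.le_sup' (fun p : S × A => |Q p.1 p.2|) (Finset.mem_univ (s, a))

theorem aux_supNorm_le {S A : Type*} [Fintype S] [Fintype A] [Nonempty S] [Nonempty A]
    (Q : S → A → ℝ) (M : ℝ) (h : ∀ s a, |Q s a| ≤ M) : supNorm Q ≤ M :=
  Finset.sup'_le _ _ (fun p _ => h p.1 p.2)

theorem aux_hoeffding {S : Type*} [Fintype S] (w : S → ℝ) (h0 : ∀ s, 0 ≤ w s)
    (h1 : ∑ s, w s = 1) (f : S → ℝ) (B : ℝ) (hB : 0 ≤ B) (hf : ∀ s, |f s| ≤ B) (t : ℝ) :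
    ∑ s, w s * Real.exp (t * (f s - ∑ x, w x * f x)) ≤ Real.exp (B ^ 2 / 2 * t ^ 2) := by
  letI : MeasurableSpace S := ⊤
  let p : PMF S := PMF.ofFintype (fun s => ENNReal.ofReal (w s)) (by
    rw [← ENNReal.ofReal_sum_of_nonneg (fun s _ => h0 s), h1, ENNReal.ofReal_one])
  have hint : ∀ g : S → ℝ, ∫ x, g x ∂p.toMeasure = ∑ x, w x * g x := by
    intro g
    rw [PMF.integral_eq_sum]
    refine Finset.sum_congr rfl fun x _ => ?_
    simp [p, ENNReal.toReal_ofReal (h0 x)]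
  have hs := ProbabilityTheory.hasSubgaussianMGF_of_mem_Icc (μ := p.toMeasure) (X := f)
    (a := -B) (b := B) (measurable_from_top.aemeasurable)
    (Filter.Eventually.of_forall fun x => abs_le.1 (hf x))
  have := hs.mgf_le t
  rw [ProbabilityTheory.mgf, hint, hint] at this
  refine this.trans (le_of_eq ?_)
  congr 1
  have : ((‖B - -B‖₊ / 2 : NNReal) : ℝ) = B := by
    push_cast
    rw [Real.norm_eq_abs, abs_of_nonneg (by linarith)]
    ring
  push_cast at this ⊢
  rw [this]
  ring

theorem aux_prod_mgf {S ι : Type*} [Fintype S] [Fintype ι] [DecidableEq ι] (w : ι → S → ℝ)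
    (h0 : ∀ i s, 0 ≤ w i s)
    (h1 : ∀ i, ∑ s, w i s = 1) (f : S → ℝ) (B : ℝ) (hB : 0 ≤ B) (hf : ∀ s, |f s| ≤ B)
    (t : ι → ℝ) :
    ∑ ω : ι → S, (∏ i, w i (ω i)) * Real.exp (∑ i, t i * (f (ω i) - ∑ x, w i x * f x))
      ≤ Real.exp (B ^ 2 / 2 * ∑ i, t i ^ 2) := by
  have : ∑ ω : ι → S, (∏ i, w i (ω i)) * Real.exp (∑ i, t i * (f (ω i) - ∑ x, w i x * f x))
      = ∏ i, ∑ s, w i s * Real.exp (t i * (f s - ∑ x, w i x * f x)) := by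
    rw [Finset.prod_univ_sum]
    simp [Real.exp_sum, Finset.prod_mul_distrib]
  rw [this, Finset.mul_sum, Real.exp_sum]
  exact Finset.prod_le_prod
    (fun i _ => Finset.sum_nonneg fun s _ => mul_nonneg (h0 i s) (Real.exp_pos _).le)
    (fun i _ => aux_hoeffding _ (h0 i) (h1 i) f B hB hf _)

/-- deterministic part -/
theorem aux_det {S A : Type*} [Fintype S] [Fintype A] [Nonempty S] [Nonempty A]
    (r : S → A → ℝ) (P : S → A → S → ℝ) (γ : ℝ) (hγ0 : 0 < γ) (hγ1 : γ < 1)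
    (m : ℕ) (hm : 1 ≤ m) (Qstar : S → A → ℝ) (hfix : bellman r P γ Qstar = Qstar)
    (ω : S × A × Fin m → S) (τ : ℝ) (V : S → ℝ)
    (hV : V = fun s => Finset.univ.sup' Finset.univ_nonempty (fun a' => Qstar s a'))
    (hτ : ∀ s a, |∑ j : Fin m, (V (ω (s, a, j)) - ∑ x, P s a x * V x)| ≤ m * τ)
    (Qhat : S → A → ℝ) (hQ : empBellman m ω r γ Qhat = Qhat) :
    supNorm (fun s a => Qhat s a - Qstar s a) ≤ γ * τ / (1 - γ) := by
  have hm' : (0 : ℝ) < m := by exact_mod_cast hm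
  set M := supNorm (fun s a => Qhat s a - Qstar s a) with hM
  have key : M ≤ γ * M + γ * τ := by
    apply aux_supNorm_le
    intro s a
    have e1 := congrFun (congrFun hQ s) a
    have e2 := congrFun (congrFun hfix s) a
    simp only [empBellman] at e1
    simp only [bellman] at e2
    have e2' : r s a + γ * ∑ x, P s a x * V x = Qstar s a := by rw [hV]; exact e2
    have hd : |∑ j : Fin m, (Finset.univ.sup' Finset.univ_nonempty
        (fun a' => Qhat (ω (s, a, j)) a') - V (ω (s, a, j)))| ≤ m * M := by
      refine (Finset.abs_sum_le_sum_abs _ _).trans ?_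
      refine (Finset.sum_le_sum (g := fun _ => M) fun j _ => ?_).trans (by simp)
      rw [hV]
      exact aux_sup_sub _ _ _ fun a' =>
        aux_le_supNorm (fun s a => Qhat s a - Qstar s a) (ω (s, a, j)) a'
    have hd2 := hτ s a
    rw [Finset.sum_sub_distrib] at hd hd2
    simp only [Finset.sum_const, Finset.card_univ, Fintype.card_fin, nsmul_eq_mul] at hd2
    have : Qhat s a - Qstar s a = γ / m * ((∑ j : Fin m, Finset.univ.sup' Finset.univ_nonempty
        (fun a' => Qhat (ω (s, a, j)) a') - ∑ j : Fin m, V (ω (s, a, j))) +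
        (∑ j : Fin m, V (ω (s, a, j)) - m * ∑ x, P s a x * V x)) := by
      rw [← e2']
      conv_lhs => rw [← e1]
      field_simp
      ring
    rw [this, abs_mul, abs_of_pos (div_pos hγ0 hm')]
    calc _ ≤ γ / m * (m * M + m * τ) := by
          gcongr
          exact (abs_add_le _ _).trans (add_le_add hd hd2)
      _ = _ := by field_simp
  rw [le_div_iff₀ (by linarith)]
  linarith

theorem aux_V_bound {S A : Type*} [Fintype S] [Fintype A] [Nonempty S] [Nonempty A]
    (r : S → A → ℝ) (P : S → A → S → ℝ) (γ : ℝ) (hγ0 : 0 < γ) (hγ1 : γ < 1)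
    (hP0 : ∀ s a s', 0 ≤ P s a s') (hP1 : ∀ s a, ∑ s' : S, P s a s' = 1)
    (rtil : ℝ) (hr : ∀ s a, |r s a| ≤ rtil)
    (Qstar : S → A → ℝ) (hfix : bellman r P γ Qstar = Qstar) (s : S) :
    |Finset.univ.sup' Finset.univ_nonempty (fun a' => Qstar s a')| ≤ rtil / (1 - γ) := by
  have hM : supNorm Qstar ≤ rtil + γ * supNorm Qstar := by
    apply aux_supNorm_le
    intro s a
    have e2 := congrFun (congrFun hfix s) a
    simp only [bellman] at e2
    rw [← e2]
    refine (abs_add_le _ _).trans (add_le_add (hr s a) ?_)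
    rw [abs_mul, abs_of_pos hγ0]
    gcongr
    refine (Finset.abs_sum_le_sum_abs _ _).trans ?_
    calc _ ≤ ∑ x, P s a x * supNorm Qstar := by
          refine Finset.sum_le_sum fun x _ => ?_
          rw [abs_mul, abs_of_nonneg (hP0 s a x)]
          exact mul_le_mul_of_nonneg_left
            (aux_sup_abs _ _ fun a' => aux_le_supNorm Qstar x a') (hP0 s a x)
      _ = _ := by rw [← Finset.sum_mul, hP1, one_mul]
  refine (aux_sup_abs _ _ fun a' => aux_le_supNorm Qstar s a').trans ?_
  rw [le_div_iff₀ (by linarith)]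
  linarith

theorem aux_tail {S A : Type*} [Fintype S] [Fintype A]
    (P : S → A → S → ℝ)
    (hP0 : ∀ s a s', 0 ≤ P s a s') (hP1 : ∀ s a, ∑ s' : S, P s a s' = 1)
    (m : ℕ) [DecidableEq (S × A × Fin m)] (V : S → ℝ) (B : ℝ) (hB : 0 < B) (hV : ∀ s, |V s| ≤ B) (s : S) (a : A) (l : ℝ) :
    ∑ ω : S × A × Fin m → S, samplePmf m P ω *
      Real.exp (l * ∑ j : Fin m, (V (ω (s, a, j)) - ∑ x, P s a x * V x))
      ≤ Real.exp (B ^ 2 / 2 * (m * l ^ 2)) := by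
  classical
  have hred : ∀ F : S × A × Fin m → ℝ,
      ∑ q : S × A × Fin m, (if q.1 = s ∧ q.2.1 = a then F q else 0) = ∑ j, F (s, a, j) := by
    intro F
    simp only [Fintype.sum_prod_type, ite_and]
    rw [Finset.sum_eq_single s]
    · rw [Finset.sum_eq_single a]
      · simp
      · intro b _ hb; simp [hb]
      · simp
    · intro b _ hb; simp [hb]
    · simp
  have := aux_prod_mgf (ι := S × A × Fin m) (fun q => P q.1 q.2.1) (fun q => hP0 _ _)
    (fun q => hP1 _ _) V B hB.le hV (fun q => if q.1 = s ∧ q.2.1 = a then l else 0)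
  simp only [ite_mul, zero_mul, ite_pow, ne_eq, OfNat.ofNat_ne_zero, not_false_eq_true,
    zero_pow] at this
  rw [hred (fun _ => l ^ 2)] at this
  have h2 : ∀ ω : S × A × Fin m → S, ∑ q : S × A × Fin m, (if q.1 = s ∧ q.2.1 = a then
      l * (V (ω q) - ∑ x, P q.1 q.2.1 x * V x) else 0) =
      l * ∑ j : Fin m, (V (ω (s, a, j)) - ∑ x, P s a x * V x) := by
    intro ω
    rw [hred (fun q => l * (V (ω q) - ∑ x, P q.1 q.2.1 x * V x)), Finset.mul_sum]
  simp only [h2] at this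
  simpa [samplePmf] using this

open Classical in
/-- Controlling the Bellman noise: with probability at least `1 − ρ` over the
`m` i.i.d. next-state samples drawn per state-action pair, every fixed point
of the empirical Bellman operator deviates from the exact fixed point by at
most `(γ·r̃/(1−γ)²)·√(2·ln(2N/ρ)/m)` in sup norm, where `N = |S|·|A|`. -/
theorem bellman_noise_control {S A : Type*}
    [Fintype S] [Fintype A] [Nonempty S] [Nonempty A]
    (r : S → A → ℝ) (P : S → A → S → ℝ) (γ : ℝ)
    (hγ0 : 0 < γ) (hγ1 : γ < 1)
    (hP0 : ∀ s a s', 0 ≤ P s a s')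
    (hP1 : ∀ s a, ∑ s' : S, P s a s' = 1)
    (m : ℕ) (hm : 1 ≤ m)
    (rtil : ℝ) (hrtil : 0 < rtil)
    (hr : ∀ s a, |r s a| ≤ rtil)
    (Qstar : S → A → ℝ) (hfix : bellman r P γ Qstar = Qstar)
    (ρ : ℝ) (hρ0 : 0 < ρ) (hρ1 : ρ < 1) :
    1 - ρ ≤
      ∑ ω : S × A × Fin m → S,
        if (∀ Qhat : S → A → ℝ, empBellman m ω r γ Qhat = Qhat →
            supNorm (fun s a => Qhat s a - Qstar s a) ≤
              (γ * rtil / (1 - γ) ^ 2) *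
                Real.sqrt (2 * Real.log
                  (2 * ((Fintype.card S : ℝ) * (Fintype.card A : ℝ)) / ρ) / (m : ℝ)))
        then samplePmf m P ω else 0 := by
  set N : ℝ := (Fintype.card S : ℝ) * (Fintype.card A : ℝ) with hN
  have hN1 : 1 ≤ N := by
    have h1 : 1 ≤ Fintype.card S * Fintype.card A :=
      Nat.mul_pos Fintype.card_pos Fintype.card_pos
    rw [hN]; exact_mod_cast h1
  have hm' : (0 : ℝ) < m := by exact_mod_cast hm
  set L := Real.log (2 * N / ρ) with hL
  have hL0 : 0 < L := Real.log_pos (by rw [lt_div_iff₀ hρ0]; linarith)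
  have hγ' : 0 < 1 - γ := by linarith
  obtain ⟨B, hBdef⟩ : ∃ B, B = rtil / (1 - γ) := ⟨_, rfl⟩
  have hB : 0 < B := by rw [hBdef]; positivity
  obtain ⟨V, hVdef⟩ : ∃ V : S → ℝ, V = fun s => Finset.univ.sup' Finset.univ_nonempty
    (fun a' => Qstar s a') := ⟨_, rfl⟩
  have hV : ∀ s, |V s| ≤ B := by
    intro s
    rw [hVdef, hBdef]
    exact aux_V_bound r P γ hγ0 hγ1 hP0 hP1 rtil hr Qstar hfix s
  obtain ⟨τ, hτ⟩ : ∃ τ, τ = B * Real.sqrt (2 * L / m) := ⟨_, rfl⟩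
  have hτ0 : 0 < τ := by rw [hτ]; positivity
  have hτ2 : τ ^ 2 = B ^ 2 * (2 * L / m) := by
    rw [hτ, mul_pow, Real.sq_sqrt (by positivity)]
  have hbound : γ * rtil / (1 - γ) ^ 2 * Real.sqrt (2 * L / m) = γ * τ / (1 - γ) := by
    rw [hτ, hBdef]; field_simp
  rw [hbound]
  let D : (S × A × Fin m → S) → S × A → ℝ := fun ω q =>
    ∑ j : Fin m, (V (ω (q.1, q.2, j)) - ∑ x, P q.1 q.2 x * V x)
  obtain ⟨l, hl⟩ : ∃ l, l = τ / B ^ 2 := ⟨_, rfl⟩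
  have hl0 : 0 < l := by rw [hl]; positivity
  have hp0 : ∀ ω, 0 ≤ samplePmf m P ω := fun ω => Finset.prod_nonneg fun q _ => hP0 _ _ _
  have hp1 : ∑ ω, samplePmf m P ω = 1 := by
    have := Finset.prod_univ_sum (ι := S × A × Fin m) (fun _ => (Finset.univ : Finset S))
      (fun q x => P q.1 q.2.1 x)
    simp only [hP1, Finset.prod_const_one, Fintype.piFinset_univ] at this
    exact this.symm
  have hpt : ∀ ω : S × A × Fin m → S,
      samplePmf m P ω - ∑ q : S × A, Real.exp (-(l * (m * τ))) *
        (samplePmf m P ω * Real.exp (l * D ω q) + samplePmf m P ω * Real.exp (-l * D ω q)) ≤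
      if (∀ Qhat : S → A → ℝ, empBellman m ω r γ Qhat = Qhat →
            supNorm (fun s a => Qhat s a - Qstar s a) ≤ γ * τ / (1 - γ))
        then samplePmf m P ω else 0 := by
    intro ω
    have hnn : ∀ q ∈ (Finset.univ : Finset (S × A)), 0 ≤ Real.exp (-(l * (m * τ))) *
        (samplePmf m P ω * Real.exp (l * D ω q) + samplePmf m P ω * Real.exp (-l * D ω q)) := by
      intro q _
      have := hp0 ω
      positivity
    split_ifs with h
    · have := Finset.sum_nonneg hnn
      linarith
    · have : ∃ q : S × A, m * τ < |D ω q| := by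
        by_contra hcon
        push Not at hcon
        exact h fun Qhat hQ => aux_det r P γ hγ0 hγ1 m hm Qstar hfix ω τ V hVdef
          (fun s a => hcon (s, a)) Qhat hQ
      obtain ⟨q, hq⟩ := this
      have h1 := Finset.single_le_sum hnn (Finset.mem_univ q)
      refine sub_nonpos.2 (le_trans ?_ h1)
      have h3 : 1 ≤ Real.exp (-(l * (m * τ))) * (Real.exp (l * D ω q) + Real.exp (-l * D ω q)) := by
        rw [mul_add, ← Real.exp_add, ← Real.exp_add]
        rcases lt_abs.1 hq with h | h
        · have : 1 ≤ Real.exp (-(l * (m * τ)) + l * D ω q) := by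
            apply Real.one_le_exp
            nlinarith
          have := Real.exp_pos (-(l * (m * τ)) + -l * D ω q)
          linarith
        · have : 1 ≤ Real.exp (-(l * (m * τ)) + -l * D ω q) := by
            apply Real.one_le_exp
            nlinarith
          have := Real.exp_pos (-(l * (m * τ)) + l * D ω q)
          linarith
      calc samplePmf m P ω = samplePmf m P ω * 1 := (mul_one _).symm
        _ ≤ _ := mul_le_mul_of_nonneg_left h3 (hp0 ω)
        _ = _ := by ring
  refine le_trans ?_ (Finset.sum_le_sum fun ω _ => hpt ω)
  rw [Finset.sum_sub_distrib, hp1, Finset.sum_comm]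
  have hexp : Real.exp (-(l * (m * τ))) * Real.exp (B ^ 2 / 2 * (m * l ^ 2)) = ρ / (2 * N) := by
    rw [← Real.exp_add]
    have : -(l * (m * τ)) + B ^ 2 / 2 * (m * l ^ 2) = -L := by
      have : -(l * (m * τ)) + B ^ 2 / 2 * (m * l ^ 2) = - (m * τ ^ 2 / (2 * B ^ 2)) := by
        rw [hl]; field_simp; ring
      rw [this, hτ2]; field_simp
    rw [this, Real.exp_neg, hL, Real.exp_log (by positivity), inv_div]
  have hfin : ∑ q : S × A, ∑ ω : S × A × Fin m → S, Real.exp (-(l * (m * τ))) *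
        (samplePmf m P ω * Real.exp (l * D ω q) + samplePmf m P ω * Real.exp (-l * D ω q)) ≤
      ∑ q : S × A, ρ / N := by
    refine Finset.sum_le_sum fun q _ => ?_
    rw [← Finset.mul_sum, Finset.sum_add_distrib]
    have t1 := aux_tail P hP0 hP1 m V B hB hV q.1 q.2 l
    have t2 := aux_tail P hP0 hP1 m V B hB hV q.1 q.2 (-l)
    rw [neg_sq] at t2
    calc _ ≤ Real.exp (-(l * (m * τ))) * (Real.exp (B ^ 2 / 2 * (m * l ^ 2)) +
          Real.exp (B ^ 2 / 2 * (m * l ^ 2))) :=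
          mul_le_mul_of_nonneg_left (add_le_add t1 t2) (Real.exp_pos _).le
      _ = ρ / N := by rw [mul_add, hexp]; field_simp; ring
  have hlast : ∑ q : S × A, ρ / N = ρ := by
    rw [Finset.sum_const, Finset.card_univ, Fintype.card_prod, nsmul_eq_mul, Nat.cast_mul, ← hN]
    field_simp
  linarith
end

section
/- For every integer k ≥ 1, every t ∈ ℕ, every permutation π of Fin k, and all s_g ∈ S_g, s : Fin k → S_l, and a ∈ A_g, the subsampled Q-iterates satisfy Q_k^t(s_g, s ∘ π, a) = Q_k^t(s_g, s, a); that is, the subsampled Q-iterates are invariant under permutations of the local agents, and hence depend on the local-state tuple only through its empirical distribution. -/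
/-- The subsampled Q-iterates `Q_k^t`, defined by `Q_k^0 ≡ 0` and
`Q_k^{t+1}(s_g, s, a) = r_g(s_g,a) + (1/k)·Σ_i r_l(s(i), s_g)
  + γ·Σ_{s_g'} Σ_{s'} P_g(s_g,a)(s_g')·(Π_i P_l(s(i),s_g)(s'(i)))·max_{a'} Q_k^t(s_g',s',a')`. -/
noncomputable def Qiter {Sg Sl Ag : Type*}
    [Fintype Sg] [Fintype Sl] [DecidableEq Sl] [Fintype Ag] [Nonempty Ag]
    (rg : Sg → Ag → ℝ) (rl : Sl → Sg → ℝ)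
    (Pg : Sg → Ag → Sg → ℝ) (Pl : Sl → Sg → Sl → ℝ) (γ : ℝ)
    (k : ℕ) : ℕ → Sg → (Fin k → Sl) → Ag → ℝ
  | 0 => fun _ _ _ => 0
  | t + 1 => fun sg s a =>
      rg sg a + (1 / (k : ℝ)) * ∑ i, rl (s i) sg +
        γ * ∑ sg' : Sg, ∑ s' : Fin k → Sl,
          Pg sg a sg' * (∏ i, Pl (s i) sg (s' i)) *
            Finset.univ.sup' Finset.univ_nonempty
              (fun a' => Qiter rg rl Pg Pl γ k t sg' s' a')

/-- The subsampled Q-iterates are invariant under permutations of the local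
agents: `Q_k^t(s_g, s ∘ π, a) = Q_k^t(s_g, s, a)`. -/
theorem Qiter_perm_invariant {Sg Sl Ag : Type*}
    [Fintype Sg] [Fintype Sl] [DecidableEq Sl] [Fintype Ag]
    [Nonempty Sg] [Nonempty Sl] [Nonempty Ag]
    (rg : Sg → Ag → ℝ) (rl : Sl → Sg → ℝ)
    (Pg : Sg → Ag → Sg → ℝ) (Pl : Sl → Sg → Sl → ℝ) (γ : ℝ)
    (hγ0 : 0 < γ) (hγ1 : γ < 1)
    (hPg0 : ∀ sg a sg', 0 ≤ Pg sg a sg')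
    (hPg1 : ∀ sg a, ∑ sg' : Sg, Pg sg a sg' = 1)
    (hPl0 : ∀ sl sg sl', 0 ≤ Pl sl sg sl')
    (hPl1 : ∀ sl sg, ∑ sl' : Sl, Pl sl sg sl' = 1)
    (k : ℕ) (hk : 1 ≤ k) (t : ℕ) (π : Equiv.Perm (Fin k))
    (sg : Sg) (s : Fin k → Sl) (a : Ag) :
    Qiter rg rl Pg Pl γ k t sg (s ∘ π) a = Qiter rg rl Pg Pl γ k t sg s a := by
  induction t generalizing sg s a with
  | zero => simp [Qiter]
  | succ t ih =>
    have h1 : ∑ i, rl ((s ∘ π) i) sg = ∑ i, rl (s i) sg :=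
      Equiv.sum_comp π (fun i => rl (s i) sg)
    simp only [Qiter]
    rw [h1]
    congr 2
    refine Finset.sum_congr rfl fun sg' _ => ?_
    symm
    refine Fintype.sum_equiv (Equiv.arrowCongr π.symm (Equiv.refl Sl)) _ _ fun s' => ?_
    have h2 : (Equiv.arrowCongr π.symm (Equiv.refl Sl)) s' = s' ∘ π := by
      ext i; simp [Equiv.arrowCongr]
    rw [h2]
    have h3 : ∏ i, Pl ((s ∘ π) i) sg ((s' ∘ π) i) = ∏ i, Pl (s i) sg (s' i) :=
      Equiv.prod_comp π (fun i => Pl (s i) sg (s' i))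
    rw [h3]
    simp only [ih]
end

section
/- Let S be a finite set, n ≥ 1 an integer, x : Fin n → S a population of states, k an integer with 1 ≤ k ≤ n, and ε > 0. For a k-element subset Δ of Fin n, let F_Δ(z) = (1/k)·|{i ∈ Δ : x(i) = z}|, and let F(z) = (1/n)·|{i ∈ Fin n : x(i) = z}|. Then the number of k-element subsets Δ of Fin n satisfying max_{z∈S} |F_Δ(z) − F(z)| < ε is at least (1 − 2·|S|·exp(−2·k·n·ε²/(n−k+1)))·C(n,k); equivalently, a uniformly random k-element subset Δ satisfies sup_{z∈S} |F_Δ(z) − F(z)| < ε with probability at least 1 − 2·|S|·exp(−2·k·n·ε²/(n−k+1)). -/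
lemma dkw_bern (q l : ℝ) (h0 : 0 ≤ q) (h1 : q ≤ 1) :
    1 - q + q * Real.exp l ≤ Real.exp (l * q + l ^ 2 / 8) := by
  let μ : MeasureTheory.Measure ℝ :=
    ENNReal.ofReal q • MeasureTheory.Measure.dirac 1 +
      ENNReal.ofReal (1 - q) • MeasureTheory.Measure.dirac 0
  haveI : MeasureTheory.IsProbabilityMeasure μ := by
    constructor
    simp only [μ, MeasureTheory.Measure.add_apply, MeasureTheory.Measure.smul_apply,
      MeasureTheory.measure_univ, smul_eq_mul, mul_one]
    rw [← ENNReal.ofReal_add h0 (by linarith)]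
    simp
  have hint : ∀ g : ℝ → ℝ, ∫ y, g y ∂μ = q * g 1 + (1 - q) * g 0 := by
    intro g
    rw [MeasureTheory.integral_add_measure, MeasureTheory.integral_smul_measure,
      MeasureTheory.integral_smul_measure, MeasureTheory.integral_dirac,
      MeasureTheory.integral_dirac, ENNReal.toReal_ofReal h0,
      ENNReal.toReal_ofReal (by linarith)]
    · simp
    · exact (MeasureTheory.integrable_dirac (by simp)).smul_measure (by simp)
    · exact (MeasureTheory.integrable_dirac (by simp)).smul_measure (by simp)
  have hb : ∀ᵐ y ∂μ, id y ∈ Set.Icc (0 : ℝ) 1 := by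
    simp only [μ, MeasureTheory.ae_add_measure_iff]
    constructor
    · apply MeasureTheory.Measure.ae_smul_measure
      rw [MeasureTheory.ae_dirac_eq]; simp
    · apply MeasureTheory.Measure.ae_smul_measure
      rw [MeasureTheory.ae_dirac_eq]; simp
  have h := (ProbabilityTheory.hasSubgaussianMGF_of_mem_Icc (μ := μ) (X := id)
    aemeasurable_id hb).mgf_le l
  rw [ProbabilityTheory.mgf, hint, hint] at h
  norm_num at h
  have e : 1 - q + q * Real.exp l =
      Real.exp (l * q) * (q * Real.exp (l * (1 - q)) + (1 - q) * Real.exp (-(l * q))) := by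
    have a1 : Real.exp (l * q) * Real.exp (l * (1 - q)) = Real.exp l := by
      rw [← Real.exp_add]; ring_nf
    have a2 : Real.exp (l * q) * Real.exp (-(l * q)) = 1 := by
      rw [← Real.exp_add]; simp
    linear_combination (-q) * a1 - (1 - q) * a2
  rw [e, Real.exp_add]
  refine mul_le_mul_of_nonneg_left (h.trans (le_of_eq ?_)) (Real.exp_pos _).le
  congr 1; ring

lemma dkw_double {α : Type*} [Fintype α] [DecidableEq α] (k : ℕ) (g : Finset α → ℝ) :
    ((k : ℝ) + 1) * ∑ D ∈ Finset.powersetCard (k + 1) (Finset.univ : Finset α), g D =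
      ∑ T ∈ Finset.powersetCard k (Finset.univ : Finset α), ∑ i ∈ Tᶜ, g (insert i T) := by
  have h : ((k : ℝ) + 1) * ∑ D ∈ Finset.powersetCard (k + 1) (Finset.univ : Finset α), g D =
      ∑ D ∈ Finset.powersetCard (k + 1) (Finset.univ : Finset α), ∑ i ∈ D, g D := by
    rw [Finset.mul_sum]
    refine Finset.sum_congr rfl fun D hD => ?_
    rw [Finset.sum_const, (Finset.mem_powersetCard.1 hD).2]
    simp
  rw [h, Finset.sum_sigma', Finset.sum_sigma']
  refine Finset.sum_bij' (fun p _ => ⟨p.1.erase p.2, p.2⟩) (fun p _ => ⟨insert p.2 p.1, p.2⟩)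
    ?_ ?_ ?_ ?_ ?_
  · rintro ⟨D, i⟩ h
    simp only [Finset.mem_sigma, Finset.mem_powersetCard] at h ⊢
    simp [Finset.card_erase_of_mem h.2, h.1.2]
  · rintro ⟨D, i⟩ h
    simp only [Finset.mem_sigma, Finset.mem_powersetCard, Finset.mem_compl] at h ⊢
    simp [Finset.card_insert_of_notMem h.2, h.1.2]
  · rintro ⟨D, i⟩ h
    simp only [Finset.mem_sigma] at h
    simp [Finset.insert_erase h.2]
  · rintro ⟨D, i⟩ h
    simp only [Finset.mem_sigma, Finset.mem_compl] at h
    simp [Finset.erase_insert h.2]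
  · rintro ⟨D, i⟩ h
    simp only [Finset.mem_sigma] at h
    simp [Finset.insert_erase h.2]

lemma dkw_step {α : Type*} [Fintype α] [DecidableEq α] (f : α → ℝ)
    (hf : ∀ i, f i = 0 ∨ f i = 1) (U : Finset α) (hU : 0 < U.card) (l : ℝ) :
    ∑ i ∈ U, Real.exp (l * f i) ≤
      (U.card : ℝ) * Real.exp (l * ((∑ i ∈ U, f i) / U.card) + l ^ 2 / 8) := by
  have hU' : (0 : ℝ) < U.card := by exact_mod_cast hU
  have h1 : ∑ i ∈ U, Real.exp (l * f i) = ∑ i ∈ U, (1 - f i + f i * Real.exp l) := by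
    refine Finset.sum_congr rfl fun i _ => ?_
    rcases hf i with h | h <;> simp [h]
  have h0 : 0 ≤ ∑ i ∈ U, f i := Finset.sum_nonneg fun i _ => by
    rcases hf i with h | h <;> simp [h]
  have h2 : ∑ i ∈ U, f i ≤ U.card := by
    calc ∑ i ∈ U, f i ≤ ∑ i ∈ U, (1 : ℝ) := Finset.sum_le_sum fun i _ => by
          rcases hf i with h | h <;> simp [h]
      _ = _ := by simp
  have h3 := dkw_bern ((∑ i ∈ U, f i) / U.card) l (by positivity) (by rwa [div_le_one hU'])
  refine le_trans (le_of_eq ?_) (mul_le_mul_of_nonneg_left h3 hU'.le)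
  rw [h1, Finset.sum_add_distrib, Finset.sum_sub_distrib, ← Finset.sum_mul]
  simp
  field_simp

lemma dkw_mgf {n : ℕ} (f : Fin n → ℝ) (hf : ∀ i, f i = 0 ∨ f i = 1) (m : ℝ)
    (hm : ∑ i, f i = n * m) (k : ℕ) : k ≤ n → ∀ l : ℝ,
    ∑ T ∈ Finset.powersetCard k (Finset.univ : Finset (Fin n)),
      Real.exp (l * (∑ i ∈ T, f i - k * m)) ≤
    (n.choose k : ℝ) * Real.exp (l ^ 2 / 8 * (k * (n - k + 1) / n)) := by
  induction k with
  | zero => intro _ l; simp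
  | succ k ih =>
    intro hk l
    have hk' : (k : ℝ) + 1 ≤ n := by exact_mod_cast hk
    have hk0 : (0 : ℝ) ≤ k := Nat.cast_nonneg k
    have hn : (0 : ℝ) < n := by linarith
    have ha : (0 : ℝ) < n - k := by linarith
    have key := dkw_double k (fun D : Finset (Fin n) =>
      Real.exp (l * (∑ i ∈ D, f i - ((k + 1 : ℕ) : ℝ) * m)))
    have hch : ((n.choose (k + 1) : ℕ) : ℝ) * (k + 1) = n.choose k * (n - k) := by
      have := Nat.choose_succ_right_eq n k
      have h2 : ((n.choose (k + 1) * (k + 1) : ℕ) : ℝ) = ((n.choose k * (n - k) : ℕ) : ℝ) := by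
        rw [this]
      rw [Nat.cast_mul, Nat.cast_mul, Nat.cast_sub (by omega)] at h2
      exact_mod_cast h2
    have hT : ∀ T ∈ Finset.powersetCard k (Finset.univ : Finset (Fin n)),
        ∑ i ∈ Tᶜ, Real.exp (l * (∑ i ∈ insert i T, f i - ((k + 1 : ℕ) : ℝ) * m)) ≤
        ((n - k) * Real.exp (l ^ 2 / 8)) *
          Real.exp (l * ((n - k - 1) / (n - k)) * (∑ i ∈ T, f i - k * m)) := by
      intro T hT
      have hc : T.card = k := (Finset.mem_powersetCard.1 hT).2
      have hcc : ((Tᶜ).card : ℝ) = n - k := by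
        rw [Finset.card_compl, hc, Fintype.card_fin, Nat.cast_sub (by omega)]
      have hs := dkw_step f hf Tᶜ (by rw [Finset.card_compl, hc, Fintype.card_fin]; omega) l
      have hsum : ∑ i ∈ Tᶜ, f i = n * m - ∑ i ∈ T, f i := by
        rw [← hm, ← Finset.sum_add_sum_compl T f]; ring
      rw [hcc, hsum] at hs
      calc _ = Real.exp (l * (∑ i ∈ T, f i - (k + 1) * m)) * ∑ i ∈ Tᶜ, Real.exp (l * f i) := by
            rw [Finset.mul_sum]
            refine Finset.sum_congr rfl fun i hi => ?_
            rw [Finset.sum_insert (Finset.mem_compl.1 hi), ← Real.exp_add]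
            congr 1; push_cast; ring
        _ ≤ _ := mul_le_mul_of_nonneg_left hs (Real.exp_pos _).le
        _ = _ := by
            rw [mul_left_comm, mul_assoc, ← Real.exp_add, ← Real.exp_add]
            congr 2
            field_simp
            ring
    have h1 := Finset.sum_le_sum hT
    rw [← key, ← Finset.mul_sum] at h1
    have h2 := ih (by omega) (l * ((n - k - 1) / (n - k)))
    have h3 := h1.trans (mul_le_mul_of_nonneg_left h2 (by positivity))
    have h4 : Real.exp (l ^ 2 / 8) *
        Real.exp ((l * ((n - k - 1) / (n - k))) ^ 2 / 8 * (k * (n - k + 1) / n)) ≤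
        Real.exp (l ^ 2 / 8 * (((k + 1 : ℕ) : ℝ) * (n - ((k + 1 : ℕ) : ℝ) + 1) / n)) := by
      rw [← Real.exp_add, Real.exp_le_exp]
      push_cast
      have : 1 + ((n - k - 1) / (n - k)) ^ 2 * (k * (n - k + 1) / n) ≤
          ((k : ℝ) + 1) * (n - (k + 1) + 1) / n := by
        obtain ⟨a, rfl⟩ : ∃ a : ℝ, a = (n : ℝ) - k - 1 := ⟨_, rfl⟩
        have hb : ((k : ℝ) + 1) * (n - (k + 1) + 1) / n -
          (1 + ((n - k - 1) / (n - k)) ^ 2 * (k * (n - k + 1) / n)) =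
            k * (n - k - 1) / (n * (n - k) ^ 2) := by
          field_simp
          ring
        have : (0 : ℝ) ≤ k * (n - k - 1) / (n * (n - k) ^ 2) :=
          div_nonneg (mul_nonneg hk0 (by linarith)) (by positivity)
        linarith
      nlinarith [mul_le_mul_of_nonneg_left this (by positivity : 0 ≤ l ^ 2 / 8)]
    have hkp : (0 : ℝ) < k + 1 := by linarith
    refine le_of_mul_le_mul_left ?_ hkp
    refine h3.trans ?_
    calc _ = (n.choose k * (n - k) : ℝ) * (Real.exp (l ^ 2 / 8) *
        Real.exp ((l * ((n - k - 1) / (n - k))) ^ 2 / 8 * (k * (n - k + 1) / n))) := by ring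
      _ ≤ _ := mul_le_mul_of_nonneg_left h4 (by positivity)
      _ = _ := by rw [← hch]; ring

lemma dkw_tail {n : ℕ} (f : Fin n → ℝ) (hf : ∀ i, f i = 0 ∨ f i = 1) (m : ℝ)
    (hm : ∑ i, f i = n * m) (k : ℕ) (hk1 : 1 ≤ k) (hk : k ≤ n) (ε : ℝ) (hε : 0 < ε) :
    (((Finset.powersetCard k (Finset.univ : Finset (Fin n))).filter
      (fun T => k * ε ≤ |∑ i ∈ T, f i - k * m|)).card : ℝ) ≤
    2 * Real.exp (-(2 * (k : ℝ) * (n : ℝ) * ε ^ 2) / ((n : ℝ) - (k : ℝ) + 1)) *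
      n.choose k := by
  have hk0 : (1 : ℝ) ≤ k := by exact_mod_cast hk1
  have hkn : (k : ℝ) ≤ n := by exact_mod_cast hk
  have hn : (0 : ℝ) < n := by linarith
  have hb : (0 : ℝ) < n - k + 1 := by linarith
  obtain ⟨l, hl⟩ : ∃ l : ℝ, l = 4 * n * ε / (n - k + 1) := ⟨_, rfl⟩
  have hl0 : 0 < l := by rw [hl]; positivity
  have p1 := dkw_mgf f hf m hm k hk l
  have p2 := dkw_mgf f hf m hm k hk (-l)
  have hE : ∀ y : ℝ, k * ε ≤ |y| →
      1 ≤ Real.exp (-(l * (k * ε))) * (Real.exp (l * y) + Real.exp (-l * y)) := by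
    intro y hy
    rw [mul_add, ← Real.exp_add, ← Real.exp_add]
    rcases le_abs.1 hy with h | h
    · have : 1 ≤ Real.exp (-(l * (k * ε)) + l * y) := Real.one_le_exp (by nlinarith)
      linarith [Real.exp_pos (-(l * (k * ε)) + -l * y)]
    · have : 1 ≤ Real.exp (-(l * (k * ε)) + -l * y) := Real.one_le_exp (by nlinarith)
      linarith [Real.exp_pos (-(l * (k * ε)) + l * y)]
  rw [Finset.card_eq_sum_ones, Nat.cast_sum]
  calc _ ≤ ∑ T ∈ Finset.filter (fun T => k * ε ≤ |∑ i ∈ T, f i - k * m|)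
            (Finset.powersetCard k (Finset.univ : Finset (Fin n))), Real.exp (-(l * (k * ε))) *
        (Real.exp (l * (∑ i ∈ T, f i - k * m)) + Real.exp (-l * (∑ i ∈ T, f i - k * m))) := by
        refine Finset.sum_le_sum fun T hT => ?_
        rw [Nat.cast_one]
        exact hE _ (Finset.mem_filter.1 hT).2
    _ ≤ ∑ T ∈ Finset.powersetCard k (Finset.univ : Finset (Fin n)), Real.exp (-(l * (k * ε))) *
        (Real.exp (l * (∑ i ∈ T, f i - k * m)) + Real.exp (-l * (∑ i ∈ T, f i - k * m))) :=
        Finset.sum_le_sum_of_subset_of_nonneg (Finset.filter_subset _ _)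
          fun T _ _ => by positivity
    _ ≤ Real.exp (-(l * (k * ε))) *
        (2 * ((n.choose k : ℝ) * Real.exp (l ^ 2 / 8 * (k * (n - k + 1) / n)))) := by
        rw [← Finset.mul_sum, Finset.sum_add_distrib]
        rw [neg_sq] at p2
        exact mul_le_mul_of_nonneg_left (by linarith) (Real.exp_pos _).le
    _ = 2 * (Real.exp (-(l * (k * ε))) * Real.exp (l ^ 2 / 8 * (k * (n - k + 1) / n))) *
        n.choose k := by ring
    _ = _ := by
        rw [← Real.exp_add]
        congr 3
        rw [hl]
        field_simp
        ring

open Classical in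
/-- DKW-type concentration for sampling `k` items uniformly without
replacement from a population of `n` items: the number of `k`-element subsets
`Δ` of `Fin n` whose empirical distribution is uniformly `ε`-close to the
population distribution is at least
`(1 − 2·|S|·exp(−2·k·n·ε²/(n−k+1)))·C(n,k)`. -/
theorem sampling_without_replacement_dkw {S : Type*} [Fintype S] [DecidableEq S]
    (n : ℕ) (hn : 1 ≤ n) (x : Fin n → S)
    (k : ℕ) (hk1 : 1 ≤ k) (hkn : k ≤ n) (ε : ℝ) (hε : 0 < ε) :
    (1 - 2 * (Fintype.card S : ℝ) *
        Real.exp (-(2 * (k : ℝ) * (n : ℝ) * ε ^ 2) / ((n : ℝ) - (k : ℝ) + 1))) *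
        (n.choose k : ℝ) ≤
      (((Finset.powersetCard k (Finset.univ : Finset (Fin n))).filter
        (fun Δ : Finset (Fin n) =>
          ∀ z : S,
            |(1 / (k : ℝ)) * ((Δ.filter (fun i => x i = z)).card : ℝ) -
              (1 / (n : ℝ)) * ((Finset.univ.filter (fun i => x i = z)).card : ℝ)| < ε)).card
        : ℝ) := by
  have hk0 : (0 : ℝ) < k := by exact_mod_cast hk1
  have hn0 : (0 : ℝ) < n := by exact_mod_cast hn
  set e := Real.exp (-(2 * (k : ℝ) * (n : ℝ) * ε ^ 2) / ((n : ℝ) - (k : ℝ) + 1)) with he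
  set P := Finset.powersetCard k (Finset.univ : Finset (Fin n)) with hP
  let f : S → Fin n → ℝ := fun z i => if x i = z then 1 else 0
  let m : S → ℝ := fun z => (1 / (n : ℝ)) * ∑ i, f z i
  let bad : S → Finset (Finset (Fin n)) := fun z =>
    P.filter (fun T => k * ε ≤ |∑ i ∈ T, f z i - k * m z|)
  have hbad : ∀ z, ((bad z).card : ℝ) ≤ 2 * e * n.choose k := fun z =>
    dkw_tail (f z) (fun i => by by_cases h : x i = z <;> simp [f, h]) (m z)
      (by simp only [m]; field_simp) k hk1 hkn ε hε
  have hsub : ∀ G : Finset (Finset (Fin n)), (∀ T ∈ P, (∀ z, T ∉ bad z) → T ∈ G) →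
      (1 - 2 * (Fintype.card S : ℝ) * e) * (n.choose k : ℝ) ≤ (G.card : ℝ) := by
    intro G hG
    have h1 : P ⊆ G ∪ Finset.univ.biUnion bad := by
      intro T hT
      by_cases h : ∀ z, T ∉ bad z
      · exact Finset.mem_union_left _ (hG T hT h)
      · push Not at h
        obtain ⟨z, hz⟩ := h
        exact Finset.mem_union_right _ (Finset.mem_biUnion.2 ⟨z, Finset.mem_univ _, hz⟩)
    have h2 : P.card ≤ G.card + ∑ z, (bad z).card :=
      (Finset.card_le_card h1).trans ((Finset.card_union_le _ _).trans
        (Nat.add_le_add_left Finset.card_biUnion_le _))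
    have h3 : P.card = n.choose k := by simp [hP]
    rw [h3] at h2
    have h4 : (n.choose k : ℝ) ≤ G.card + ∑ z, ((bad z).card : ℝ) := by exact_mod_cast h2
    have h5 : ∑ z, ((bad z).card : ℝ) ≤ Fintype.card S * (2 * e * n.choose k) := by
      refine (Finset.sum_le_sum fun z _ => hbad z).trans (le_of_eq ?_)
      simp
    linarith
  apply hsub
  intro T hT hz
  rw [Finset.mem_filter]
  refine ⟨hT, fun z => ?_⟩
  have h := hz z
  simp only [bad, Finset.mem_filter, hT, true_and, not_le] at h
  have hc : ∀ U : Finset (Fin n), ((U.filter (fun i => x i = z)).card : ℝ) = ∑ i ∈ U, f z i := by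
    intro U
    simp [f]
  rw [hc, hc]
  have h6 : (1 / (k : ℝ)) * ∑ i ∈ T, f z i - (1 / (n : ℝ)) * ∑ i, f z i =
      (∑ i ∈ T, f z i - k * m z) / k := by
    simp only [m]; field_simp
  rw [h6, abs_div, abs_of_pos hk0, div_lt_iff₀ hk0]
  linarith
end
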